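/- (Theorem 3, approximation guarantee) Let g : (k+1)^𝒳 → ℝ≥0 be a normalized k-submodular function, w : 𝒳 → ℝ>0 a positive weight function, τ > 0 with τ ≤ max_{s∈(k+1)^𝒳} g(s), ε ∈ (0,1), let v be a k-set of minimum weight among those with g(v) ≥ τ, and let B satisfy w(v) ≤ B. If g is monotone, the k-set x returned by Algorithm 3 with inputs (τ, B, ε) satisfies w(x) ≤ ((3−ε)/(2ε(1−ε)))·w(v) and g(x) ≥ (1−ε)τ/2; if k ≥ 2 and g is not assumed monotone, the returned x satisfies w(x) ≤ ((4−ε)/(3ε(1−ε)))·w(v) and g(x) ≥ (1−ε)τ/3. -/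

import Mathlib

/-- A `k`-set: an assignment of each ground element to one of `k` parts or to none
(`none` meaning the element belongs to no part).  This encodes a tuple
`(S_1, …, S_k)` of pairwise disjoint subsets of `X`. -/
abbrev KSet (X : Type*) (k : ℕ) := X → Option (Fin k)

namespace KSet

variable {X : Type*} {k : ℕ}

/-- The empty `k`-set `𝟎 = (∅, …, ∅)`. -/
def bot (X : Type*) (k : ℕ) : KSet X k := fun _ => none

/-- `le s t` is the partial order `s ⊑ t`, i.e. `Sᵢ ⊆ Tᵢ` for every `i ∈ [k]`. -/
def le (s t : KSet X k) : Prop := ∀ (x : X) (i : Fin k), s x = some i → t x = some i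

/-- The meet `s ⊓ t`, whose `i`-th component is `Sᵢ ∩ Tᵢ`. -/
def meet (s t : KSet X k) : KSet X k := fun x => if s x = t x then s x else none

/-- The join `s ⊔ t`, whose `i`-th component is `(Sᵢ ∪ Tᵢ) \ ⋃_{j ≠ i} (Sⱼ ∪ Tⱼ)`. -/
def join (s t : KSet X k) : KSet X k := fun x =>
  match s x, t x with
  | none, b => b
  | some i, none => some i
  | some i, some j => if i = j then some i else none

/-- The `k`-set `(x, i)` whose only nonempty component is `Sᵢ = {x}`. -/
def single [DecidableEq X] (x : X) (i : Fin k) : KSet X k :=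
  fun y => if y = x then some i else none

/-- `s ⊔ (x, i)`: add the element `x` to the `i`-th part of `s`
(intended for `x ∉ E(s)`). -/
def add [DecidableEq X] (s : KSet X k) (x : X) (i : Fin k) : KSet X k :=
  Function.update s x (some i)

end KSet

/-- The marginal gain `Δ_{x,i} g (s) = g (s ⊔ (x,i)) - g s`. -/
def marg {X : Type*} [DecidableEq X] {k : ℕ} (g : KSet X k → ℝ) (s : KSet X k)
    (x : X) (i : Fin k) : ℝ :=
  g (KSet.add s x i) - g s

/-- `g` is `k`-submodular: `g (s ⊓ t) + g (s ⊔ t) ≤ g s + g t` for all `k`-sets. -/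
def KSubmodular {X : Type*} {k : ℕ} (g : KSet X k → ℝ) : Prop :=
  ∀ s t : KSet X k, g (KSet.meet s t) + g (KSet.join s t) ≤ g s + g t

/-- `g` is monotone with respect to `⊑`. -/
def KMonotone {X : Type*} {k : ℕ} (g : KSet X k → ℝ) : Prop :=
  ∀ s t : KSet X k, KSet.le s t → g s ≤ g t

/-- The weight `w(s) = ∑_{x ∈ E(s)} w x` of a `k`-set. -/
def wtot {X : Type*} [Fintype X] {k : ℕ} (w : X → ℝ) (s : KSet X k) : ℝ :=
  ∑ x ∈ Finset.univ.filter (fun x => s x ≠ none), w x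

/-- A greedy chain for `g`: `c 0 = 𝟎` and each step adds one new element at a
position maximizing the marginal gain over `i ∈ [k]`. -/
def GreedyChain {X : Type*} [DecidableEq X] {k : ℕ} (g : KSet X k → ℝ) (m : ℕ)
    (c : ℕ → KSet X k) : Prop :=
  c 0 = KSet.bot X k ∧
  ∀ p, p < m → ∃ (xp : X) (ip : Fin k),
    c p xp = none ∧
    c (p + 1) = KSet.add (c p) xp ip ∧
    ∀ i : Fin k, marg g (c p) xp i ≤ marg g (c p) xp ip

/-- A choice of position in `[k]` maximizing `f`. -/
noncomputable def argmaxFin {k : ℕ} [NeZero k] (f : Fin k → ℝ) : Fin k :=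
  Classical.choose (Finset.exists_max_image Finset.univ f
    ⟨⟨0, Nat.pos_of_ne_zero (NeZero.ne k)⟩, Finset.mem_univ _⟩)

open Classical in
/-- One step of Algorithm 1, processing the arriving element `x` with current
solution `s`, threshold `τ`, density threshold `θ` and cost upper bound `A`:
if `x` is big (`w x ≤ A` and `max_i g((x,i)) ≥ τ`) then restart from `(x,i')`
with `i'` maximizing `g((x,i))`; otherwise add `(x,i')` with `i'` maximizing the
marginal gain, provided `Δ_{x,i'}g(s)/w(x) ≥ θ` and `w(s) + w(x) ≤ A`. -/
noncomputable def alg1Step {X : Type*} [Fintype X] [DecidableEq X] {k : ℕ} [NeZero k]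
    (g : KSet X k → ℝ) (w : X → ℝ) (τ θ A : ℝ) (s : KSet X k) (x : X) : KSet X k :=
  if w x ≤ A ∧ τ ≤ g (KSet.single x (argmaxFin fun i => g (KSet.single x i))) then
    KSet.single x (argmaxFin fun i => g (KSet.single x i))
  else if θ ≤ marg g s x (argmaxFin fun i => marg g s x i) / w x ∧ wtot w s + w x ≤ A then
    KSet.add s x (argmaxFin fun i => marg g s x i)
  else s

/-- Algorithm 1: starting from `𝟎`, process the elements of the ground set in
their arrival order `order`. -/
noncomputable def alg1 {X : Type*} [Fintype X] [DecidableEq X] {k : ℕ} [NeZero k]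
    (g : KSet X k → ℝ) (w : X → ℝ) (τ θ A : ℝ) (order : List X) : KSet X k :=
  order.foldl (alg1Step g w τ θ A) (KSet.bot X k)

/-- `x` is a big element: `w x ≤ A` and `max_{i ∈ [k]} g((x,i)) ≥ τ`. -/
def IsBig {X : Type*} [DecidableEq X] {k : ℕ} (g : KSet X k → ℝ) (w : X → ℝ)
    (τ A : ℝ) (x : X) : Prop :=
  w x ≤ A ∧ ∃ i : Fin k, τ ≤ g (KSet.single x i)

/-- The state of Algorithm 3: the lower bound `L` on the guessed optimal weight
(`none` stands for the initial value `-∞`), the upper bound `U`, and a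
candidate solution `x_j` for every guess index `j` (guesses `λ_j = (1-ε)^j·B`). -/
structure Alg3State (X : Type*) (k : ℕ) where
  L : Option ℝ
  U : ℝ
  sol : ℕ → KSet X k

open Classical in
/-- One step of Algorithm 3, processing the arriving element `x`.  First the
lower bound `L` is updated (the condition `g((x,i'))/w(x) > ετ/L` with
`L = -∞` reads `g((x,i'))/w(x) > 0`); then every active guess
`λ_j ∈ [L, U]` has its solution updated as in Algorithm 1 with `θ_j = ετ/λ_j`
and `A_j = cA·λ_j`; finally `U` is lowered to the smallest active `λ_j` whose
solution reaches value `(1-ε)τ/r`, if any. -/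
noncomputable def alg3Step {X : Type*} [Fintype X] [DecidableEq X] {k : ℕ} [NeZero k]
    (g : KSet X k → ℝ) (w : X → ℝ) (τ ε B cA r : ℝ) (σ : Alg3State X k) (x : X) :
    Alg3State X k :=
  let gx := g (KSet.single x (argmaxFin fun i => g (KSet.single x i)))
  let L' : Option ℝ :=
    match σ.L with
    | none => if 0 < gx / w x then some (ε * τ * w x / gx) else none
    | some L => if ε * τ / L < gx / w x then some (ε * τ * w x / gx) else some L
  let active : ℕ → Prop := fun j =>
    (∀ L ∈ L', L ≤ (1 - ε) ^ j * B) ∧ (1 - ε) ^ j * B ≤ σ.U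
  let sol' : ℕ → KSet X k := fun j =>
    if active j then
      alg1Step g w τ (ε * τ / ((1 - ε) ^ j * B)) (cA * ((1 - ε) ^ j * B)) (σ.sol j) x
    else σ.sol j
  { L := L'
    U :=
      if (∃ j : ℕ, active j ∧ (1 - ε) * τ / r ≤ g (sol' j)) then
        sInf {u : ℝ | ∃ j : ℕ, u = (1 - ε) ^ j * B ∧ active j ∧ (1 - ε) * τ / r ≤ g (sol' j)}
      else σ.U
    sol := sol' }

/-- Algorithm 3: a single pass over the stream `order`, starting from
`L = -∞`, `U = B` and all candidate solutions equal to `𝟎`. -/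
noncomputable def alg3Run {X : Type*} [Fintype X] [DecidableEq X] {k : ℕ} [NeZero k]
    (g : KSet X k → ℝ) (w : X → ℝ) (τ ε B cA r : ℝ) (order : List X) :
    Alg3State X k :=
  order.foldl (alg3Step g w τ ε B cA r) ⟨none, B, fun _ => KSet.bot X k⟩

/-- `x` is a possible output of Algorithm 3: among the guesses `λ_j` lying in
`[L, U]` at the end of the pass, `x` is a solution `x_j` maximizing `g`. -/
def IsAlg3Output {X : Type*} [Fintype X] [DecidableEq X] {k : ℕ} [NeZero k]
    (g : KSet X k → ℝ) (w : X → ℝ) (τ ε B cA r : ℝ) (order : List X)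
    (x : KSet X k) : Prop :=
  ∃ j : ℕ,
    (∀ L ∈ (alg3Run g w τ ε B cA r order).L, L ≤ (1 - ε) ^ j * B) ∧
    (1 - ε) ^ j * B ≤ (alg3Run g w τ ε B cA r order).U ∧
    x = (alg3Run g w τ ε B cA r order).sol j ∧
    ∀ j' : ℕ,
      (∀ L ∈ (alg3Run g w τ ε B cA r order).L, L ≤ (1 - ε) ^ j' * B) →
      (1 - ε) ^ j' * B ≤ (alg3Run g w τ ε B cA r order).U →
      g ((alg3Run g w τ ε B cA r order).sol j') ≤ g ((alg3Run g w τ ε B cA r order).sol j)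

section Helpers

set_option linter.unusedSectionVars false

variable {X : Type*} [Fintype X] [DecidableEq X] {k : ℕ}

theorem argmaxFin_spec [NeZero k] (f : Fin k → ℝ) (i : Fin k) : f i ≤ f (argmaxFin f) := by
  unfold argmaxFin
  exact (Classical.choose_spec (Finset.exists_max_image Finset.univ f
    ⟨⟨0, Nat.pos_of_ne_zero (NeZero.ne k)⟩, Finset.mem_univ _⟩)).2 i (Finset.mem_univ _)

theorem marg_anti {g : KSet X k → ℝ} (hsub : KSubmodular g) {s t : KSet X k}
    (hst : KSet.le s t) {x : X} (hx : t x = none) (i : Fin k) :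
    marg g t x i ≤ marg g s x i := by
  have hsx : s x = none := by
    cases h : s x with
    | none => rfl
    | some j => have := hst x j h; simp_all
  have h := hsub (KSet.add s x i) t
  have h1 : KSet.meet (KSet.add s x i) t = s := by
    funext y
    by_cases hy : y = x
    · subst hy; simp [KSet.meet, KSet.add, hx, hsx]
    · simp only [KSet.meet, KSet.add, Function.update_of_ne hy]
      split_ifs with h
      · rfl
      · cases h' : s y with
        | none => rfl
        | some j => exact absurd (h'.trans (hst y j h').symm) h
  have h2 : KSet.join (KSet.add s x i) t = KSet.add t x i := by
    funext y
    by_cases hy : y = x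
    · subst hy; simp [KSet.join, KSet.add, hx]
    · simp only [KSet.join, KSet.add, Function.update_of_ne hy]
      cases h' : s y with
      | none => rfl
      | some j => simp [hst y j h']
  rw [h1, h2] at h
  unfold marg; linarith

theorem marg_pair {g : KSet X k → ℝ} (hsub : KSubmodular g) {q : KSet X k}
    {x : X} (hx : q x = none) {i j : Fin k} (hij : i ≠ j) :
    0 ≤ marg g q x i + marg g q x j := by
  have h := hsub (KSet.add q x i) (KSet.add q x j)
  have h1 : KSet.meet (KSet.add q x i) (KSet.add q x j) = q := by
    funext y
    by_cases hy : y = x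
    · subst hy; simp [KSet.meet, KSet.add, hx, hij]
    · simp [KSet.meet, KSet.add, Function.update_of_ne hy]
  have h2 : KSet.join (KSet.add q x i) (KSet.add q x j) = q := by
    funext y
    by_cases hy : y = x
    · subst hy; simp [KSet.join, KSet.add, hx, hij]
    · simp only [KSet.join, KSet.add, Function.update_of_ne hy]
      cases q y <;> simp
  rw [h1, h2] at h
  unfold marg; linarith

theorem bot_le' (s : KSet X k) : KSet.le (KSet.bot X k) s := by
  intro x i h; simp [KSet.bot] at h

theorem marg_le_single {g : KSet X k → ℝ} (hsub : KSubmodular g)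
    (hnorm : g (KSet.bot X k) = 0) {s : KSet X k} {x : X} (hx : s x = none) (i : Fin k) :
    marg g s x i ≤ g (KSet.single x i) := by
  have h := marg_anti hsub (bot_le' s) hx i
  have h2 : KSet.add (KSet.bot X k) x i = KSet.single x i := by
    funext y
    by_cases hy : y = x
    · subst hy; simp [KSet.add, KSet.single]
    · simp [KSet.add, KSet.single, hy, KSet.bot]
  unfold marg at h ⊢
  rw [h2, hnorm] at h
  linarith

theorem g_le_sum {g : KSet X k → ℝ} (hsub : KSubmodular g) {s t : KSet X k}
    (hst : KSet.le s t) (c : X → ℝ) (hc0 : ∀ x, 0 ≤ c x)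
    (hc : ∀ x, s x = none → ∀ i, t x = some i → marg g s x i ≤ c x) :
    g t ≤ g s + ∑ x ∈ Finset.univ.filter (fun x => s x = none ∧ t x ≠ none), c x := by
  have key : ∀ F : Finset X, g (fun x => if x ∈ F then t x else s x) ≤
      g s + ∑ x ∈ F, if (s x = none ∧ t x ≠ none) then c x else 0 := by
    intro F
    induction F using Finset.induction_on with
    | empty => simp
    | insert a F ha ih =>
      rw [Finset.sum_insert ha]
      by_cases hh : s a = none ∧ t a ≠ none
      · rw [if_pos hh]
        obtain ⟨i, hi⟩ := Option.ne_none_iff_exists'.1 hh.2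
        have e : (fun x => if x ∈ insert a F then t x else s x) =
            KSet.add (fun x => if x ∈ F then t x else s x) a i := by
          funext y
          by_cases hy : y = a
          · subst hy; simp [KSet.add, hi]
          · simp [KSet.add, Function.update_of_ne hy, hy]
        have hle : KSet.le s (fun x => if x ∈ F then t x else s x) := by
          intro y j hj
          simp only
          split_ifs
          · exact hst y j hj
          · exact hj
        have h1 := marg_anti hsub hle (x := a) (by simp [ha, hh.1]) i
        have h2 := hc a hh.1 i hi
        rw [e]
        unfold marg at h1 h2
        linarith
      · rw [if_neg hh]
        have e : (fun x => if x ∈ insert a F then t x else s x) =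
            (fun x => if x ∈ F then t x else s x) := by
          funext y
          by_cases hy : y = a
          · subst hy
            simp only [Finset.mem_insert_self, if_true, ha, if_false]
            cases h' : s y with
            | none => by_contra h3; exact hh ⟨h', h3⟩
            | some j => exact hst y j h'
          · simp [hy]
        rw [e]; linarith
  have := key Finset.univ
  simp only [Finset.mem_univ, if_true] at this
  rwa [Finset.sum_filter]

theorem wtot_add (w : X → ℝ) {s : KSet X k} {x : X} (hx : s x = none) (i : Fin k) :
    wtot w (KSet.add s x i) = wtot w s + w x := by
  unfold wtot
  have : Finset.univ.filter (fun y => KSet.add s x i y ≠ none) =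
      insert x (Finset.univ.filter (fun y => s y ≠ none)) := by
    ext y
    rw [Finset.mem_insert, Finset.mem_filter, Finset.mem_filter]
    by_cases hy : y = x
    · subst hy; simp [KSet.add]
    · simp [KSet.add, Function.update_of_ne hy, hy]
  rw [this, Finset.sum_insert (by simp [hx])]; ring

theorem wtot_single (w : X → ℝ) (x : X) (i : Fin k) :
    wtot w (KSet.single x i) = w x := by
  unfold wtot
  have : Finset.univ.filter (fun y => KSet.single x i y ≠ none) = {x} := by
    ext y
    by_cases hy : y = x
    · subst hy; simp [KSet.single]
    · simp [KSet.single, hy]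
  rw [this, Finset.sum_singleton]

theorem wtot_bot (w : X → ℝ) : wtot w (KSet.bot X k) = 0 := by
  simp [wtot, KSet.bot]

theorem wtot_nonneg {w : X → ℝ} (hw : ∀ x, 0 < w x) (s : KSet X k) : 0 ≤ wtot w s :=
  Finset.sum_nonneg fun x _ => (hw x).le

theorem w_le_wtot {w : X → ℝ} (hw : ∀ x, 0 < w x) {s : KSet X k} {x : X} (hx : s x ≠ none) :
    w x ≤ wtot w s :=
  Finset.single_le_sum (f := w) (fun x _ => (hw x).le) (by simp [hx])

/-- maximal singleton value -/
noncomputable def gmax [NeZero k] (g : KSet X k → ℝ) (x : X) : ℝ :=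
  g (KSet.single x (argmaxFin fun i => g (KSet.single x i)))

theorem marg_le_gmax [NeZero k] {g : KSet X k → ℝ} (hsub : KSubmodular g)
    (hnorm : g (KSet.bot X k) = 0) {s : KSet X k} {x : X} (hx : s x = none) (i : Fin k) :
    marg g s x i ≤ gmax g x :=
  (marg_le_single hsub hnorm hx i).trans (argmaxFin_spec (fun i => g (KSet.single x i)) i)

/-- The three outcomes of a step. -/
theorem alg1Step_cases [NeZero k] (g : KSet X k → ℝ) (w : X → ℝ) (hw : ∀ x, 0 < w x)
    (τ θ A : ℝ) (s : KSet X k) (x : X) :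
    (w x ≤ A ∧ τ ≤ gmax g x ∧
      ∃ i, alg1Step g w τ θ A s x = KSet.single x i ∧ g (KSet.single x i) = gmax g x) ∨
    (∃ i, alg1Step g w τ θ A s x = KSet.add s x i ∧ (∀ j, marg g s x j ≤ marg g s x i) ∧
      θ * w x ≤ marg g s x i ∧ wtot w s + w x ≤ A) ∨
    (alg1Step g w τ θ A s x = s ∧ (w x ≤ A → gmax g x < τ) ∧
      ((∀ i, marg g s x i ≤ θ * w x) ∨
        (∃ i, θ * w x ≤ marg g s x i) ∧ A < wtot w s + w x)) := by
  unfold alg1Step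
  split_ifs with h1 h2
  · exact Or.inl ⟨h1.1, h1.2, _, rfl, rfl⟩
  · refine Or.inr (Or.inl ⟨_, rfl, argmaxFin_spec (fun i => marg g s x i), ?_, h2.2⟩)
    exact (le_div_iff₀ (hw x)).1 h2.1
  · refine Or.inr (Or.inr ⟨rfl, ?_, ?_⟩)
    · intro h; by_contra h3; exact h1 ⟨h, not_lt.1 h3⟩
    · by_cases h3 : θ ≤ marg g s x (argmaxFin fun i => marg g s x i) / w x
      · right
        exact ⟨⟨_, (le_div_iff₀ (hw x)).1 h3⟩, by by_contra h4; exact h2 ⟨h3, not_lt.1 h4⟩⟩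
      · left
        intro i
        rw [le_div_iff₀ (hw x), not_le] at h3
        exact (argmaxFin_spec (fun i => marg g s x i) i).trans h3.le

theorem alg1Step_thr [NeZero k] (g : KSet X k → ℝ) (w : X → ℝ) (hw : ∀ x, 0 < w x)
    {τ θ A T : ℝ} (hθ : 0 ≤ θ) (hT : T ≤ τ) {s : KSet X k} {x : X} (h : T ≤ g s) :
    T ≤ g (alg1Step g w τ θ A s x) := by
  rcases alg1Step_cases g w hw τ θ A s x with ⟨_, h1, i, h2, h3⟩ | ⟨i, h1, _, h2, _⟩ | ⟨h1, _⟩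
  · rw [h2, h3]; linarith
  · rw [h1]
    have := mul_nonneg hθ (hw x).le
    unfold marg at h2; linarith
  · rwa [h1]

theorem alg1Step_wt [NeZero k] (g : KSet X k → ℝ) (w : X → ℝ) (hw : ∀ x, 0 < w x)
    {τ θ A : ℝ} {s : KSet X k} {x : X} (hx : s x = none) (h : wtot w s ≤ A) :
    wtot w (alg1Step g w τ θ A s x) ≤ A := by
  rcases alg1Step_cases g w hw τ θ A s x with ⟨h0, h1, i, h2, h3⟩ | ⟨i, h1, _, _, h2⟩ | ⟨h1, _⟩
  · rw [h2, wtot_single]; exact h0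
  · rw [h1, wtot_add w hx]; exact h2
  · rwa [h1]

theorem alg1Step_none [NeZero k] (g : KSet X k → ℝ) (w : X → ℝ) (hw : ∀ x, 0 < w x)
    {τ θ A : ℝ} {s : KSet X k} {x y : X} (hy : y ≠ x) (h : s y = none) :
    alg1Step g w τ θ A s x y = none := by
  rcases alg1Step_cases g w hw τ θ A s x with ⟨h0, h1, i, h2, h3⟩ | ⟨i, h1, _, _, h2⟩ | ⟨h1, _⟩
  · rw [h2]; simp [KSet.single, hy]
  · rw [h1]; simp [KSet.add, Function.update_of_ne hy, h]
  · rwa [h1]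

/-- `v` overridden by `s`. -/
def ovr (s v : KSet X k) : KSet X k := fun x => if s x = none then v x else s x

/-- Exchange property of greedy insertion. -/
def Exch (g : KSet X k → ℝ) (r : ℝ) : Prop :=
  ∀ (s q : KSet X k) (x : X) (i : Fin k), KSet.le s q → q x = none →
    (∀ j, marg g s x j ≤ marg g s x i) → 0 ≤ marg g s x i →
    ∀ a : Option (Fin k),
      g (Function.update q x a) - g (Function.update q x (some i)) ≤ (r - 1) * marg g s x i

theorem exch_mono {g : KSet X k → ℝ} (hsub : KSubmodular g) (hm : KMonotone g) : Exch g 2 := by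
  intro s q x i hsq hx hmax h0 a
  have h1 : g q ≤ g (Function.update q x (some i)) := by
    apply hm
    intro y j hj
    by_cases hy : y = x
    · subst hy; simp [hx] at hj
    · simpa [Function.update_of_ne hy] using hj
  cases a with
  | none =>
    have : Function.update q x none = q := by rw [← hx]; exact Function.update_eq_self x q
    rw [this]; linarith
  | some j =>
    have h2 := marg_anti hsub hsq hx j
    have h3 := hmax j
    have h4 : marg g q x j = g (Function.update q x (some j)) - g q := rfl
    linarith

theorem exch_pair {g : KSet X k → ℝ} (hsub : KSubmodular g) (hk : 2 ≤ k) : Exch g 3 := by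
  intro s q x i hsq hx hmax h0 a
  have : Nontrivial (Fin k) := Fin.nontrivial_iff_two_le.2 hk
  obtain ⟨j', hj'⟩ := exists_ne i
  have h1 := marg_pair hsub hx hj'
  have h2 := marg_anti hsub hsq hx j'
  have h3 := hmax j'
  have h5 : marg g q x i = g (Function.update q x (some i)) - g q := rfl
  cases a with
  | none =>
    have : Function.update q x none = q := by rw [← hx]; exact Function.update_eq_self x q
    rw [this]; linarith
  | some j =>
    have h2 := marg_anti hsub hsq hx j
    have h3 := hmax j
    have h4 : marg g q x j = g (Function.update q x (some j)) - g q := rfl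
    linarith

/-- Invariant of Algorithm 1 for the good guess. -/
def InvStar (g : KSet X k → ℝ) (w : X → ℝ) (T r θ : ℝ) (v : KSet X k) (done : List X)
    (s : KSet X k) : Prop :=
  T ≤ g s ∨
  (g v - g (ovr s v) ≤ (r - 1) * g s ∧
    (∀ x ∈ done, s x = none → ∀ i, v x = some i → marg g s x i ≤ θ * w x) ∧
    θ * wtot w s ≤ g s)

theorem invStar_skip {g : KSet X k → ℝ} {w : X → ℝ} {T r θ : ℝ} {v : KSet X k} {done : List X}
    {s : KSet X k} {x : X} (h : InvStar g w T r θ v done s)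
    (hx : ∀ i, v x = some i → marg g s x i ≤ θ * w x) :
    InvStar g w T r θ v (done ++ [x]) s := by
  rcases h with h | ⟨h1, h2, h3⟩
  · exact Or.inl h
  · refine Or.inr ⟨h1, ?_, h3⟩
    intro y hy hsy i hi
    rcases List.mem_append.1 hy with hy | hy
    · exact h2 y hy hsy i hi
    · rw [List.mem_singleton] at hy
      subst hy; exact hx i hi

theorem invStar_step [NeZero k] {g : KSet X k → ℝ} (hsub : KSubmodular g)
    (hnorm : g (KSet.bot X k) = 0) {w : X → ℝ} (hw : ∀ x, 0 < w x)
    {τ T r θ A : ℝ} (hθ : 0 ≤ θ) (hT : T ≤ τ) (hex : Exch g r) {v : KSet X k}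
    (hA : wtot w v ≤ A) (hθA : θ * A = τ + T) {done : List X}
    {s : KSet X k} {x : X} (hx : s x = none) (h : InvStar g w T r θ v done s) :
    InvStar g w T r θ v (done ++ [x]) (alg1Step g w τ θ A s x) := by
  by_cases hTs : T ≤ g s
  · exact Or.inl (alg1Step_thr g w hw hθ hT hTs)
  have h' := h.resolve_left hTs
  obtain ⟨h1, h2, h3⟩ := h'
  rcases alg1Step_cases g w hw τ θ A s x with
    ⟨_, c1, i, c2, c3⟩ | ⟨i, c1, c2, c3, c4⟩ | ⟨c1, c2, c3⟩
  · left; rw [c2, c3]; linarith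
  · right
    rw [c1]
    have hg : g (KSet.add s x i) = g s + marg g s x i := by unfold marg; ring
    have hle : KSet.le s (KSet.add s x i) := by
      intro y j hj
      by_cases hy : y = x
      · subst hy; simp [hx] at hj
      · simpa [KSet.add, Function.update_of_ne hy] using hj
    refine ⟨?_, ?_, ?_⟩
    · have e := hex s (Function.update (ovr s v) x none) x i ?_ (by simp) c2
        ((mul_nonneg hθ (hw x).le).trans c3) (ovr s v x)
      · rw [Function.update_idem, Function.update_idem, Function.update_eq_self] at e
        have e2 : ovr (KSet.add s x i) v = Function.update (ovr s v) x (some i) := by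
          funext y
          by_cases hy : y = x
          · subst hy; simp [ovr, KSet.add]
          · simp [ovr, KSet.add, Function.update_of_ne hy]
        rw [e2, hg]; linarith
      · intro y j hj
        by_cases hy : y = x
        · subst hy; simp [hx] at hj
        · simp [Function.update_of_ne hy, ovr, hj]
    · intro y hy hsy j hj
      have hyx : y ≠ x := by
        rintro rfl; simp [KSet.add] at hsy
      have hsy' : s y = none := by simpa [KSet.add, Function.update_of_ne hyx] using hsy
      have hyd : y ∈ done := by
        rcases List.mem_append.1 hy with hy | hy
        · exact hy
        · exact absurd (List.mem_singleton.1 hy) hyx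
      exact (marg_anti hsub hle hsy j).trans (h2 y hyd hsy' j hj)
    · rw [hg, wtot_add w hx]; linarith
  · rw [c1]
    rcases c3 with c3 | ⟨⟨i, c3⟩, c4⟩
    · exact invStar_skip h fun i _ => c3 i
    · by_cases hv : v x = none
      · exact invStar_skip h fun i hi => by simp [hv] at hi
      · exfalso
        have a1 := c2 ((w_le_wtot hw hv).trans hA)
        have a2 := marg_le_gmax hsub hnorm hx i
        have a3 := mul_le_mul_of_nonneg_left c4.le hθ
        apply hTs; linarith

theorem invStar_final {g : KSet X k → ℝ} (hsub : KSubmodular g)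
    {w : X → ℝ} (hw : ∀ x, 0 < w x)
    {τ T r θ : ℝ} (hθ : 0 ≤ θ) (hr : 0 < r) {v : KSet X k} (hv : τ ≤ g v)
    (hθv : θ * wtot w v + r * T ≤ τ) {done : List X} (hd : ∀ x, x ∈ done)
    {s : KSet X k} (h : InvStar g w T r θ v done s) : T ≤ g s := by
  rcases h with h | ⟨h1, h2, h3⟩
  · exact h
  have hle : KSet.le s (ovr s v) := by
    intro y j hj; simp [ovr, hj]
  have := g_le_sum hsub hle (fun x => θ * w x) (fun x => mul_nonneg hθ (hw x).le) (by
    intro x hx i hi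
    exact h2 x (hd x) hx i (by simpa [ovr, hx] using hi))
  have h5 : ∑ x ∈ Finset.univ.filter (fun x => s x = none ∧ ovr s v x ≠ none), θ * w x
      ≤ θ * wtot w v := by
    unfold wtot
    rw [Finset.mul_sum]
    apply Finset.sum_le_sum_of_subset_of_nonneg
    · intro x hx
      rw [Finset.mem_filter] at hx ⊢
      refine ⟨hx.1, ?_⟩
      simpa [ovr, hx.2.1] using hx.2.2
    · intro x _ _; exact mul_nonneg hθ (hw x).le
  have : r * T ≤ r * g s := by linarith
  exact le_of_mul_le_mul_left this hr

/-- The new lower bound. -/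
noncomputable def newL [NeZero k] (g : KSet X k → ℝ) (w : X → ℝ) (τ ε : ℝ) (L : Option ℝ)
    (x : X) : Option ℝ :=
  match L with
  | none => if 0 < gmax g x / w x then some (ε * τ * w x / gmax g x) else none
  | some L => if ε * τ / L < gmax g x / w x then some (ε * τ * w x / gmax g x) else some L

/-- Activity of a guess. -/
def Act (L : Option ℝ) (U l : ℝ) : Prop := (∀ L' ∈ L, L' ≤ l) ∧ l ≤ U

theorem step_L [NeZero k] (g : KSet X k → ℝ) (w : X → ℝ) (τ ε B cA r : ℝ) (σ : Alg3State X k)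
    (x : X) : (alg3Step g w τ ε B cA r σ x).L = newL g w τ ε σ.L x := rfl

open Classical in
theorem step_sol [NeZero k] (g : KSet X k → ℝ) (w : X → ℝ) (τ ε B cA r : ℝ) (σ : Alg3State X k)
    (x : X) (j : ℕ) : (alg3Step g w τ ε B cA r σ x).sol j =
      if Act (newL g w τ ε σ.L x) σ.U ((1 - ε) ^ j * B) then
      alg1Step g w τ (ε * τ / ((1 - ε) ^ j * B)) (cA * ((1 - ε) ^ j * B)) (σ.sol j) x
    else σ.sol j := by
  by_cases h : Act (newL g w τ ε σ.L x) σ.U ((1 - ε) ^ j * B)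
  · rw [if_pos h]; exact if_pos h
  · rw [if_neg h]; exact if_neg h

open Classical in
theorem step_U [NeZero k] (g : KSet X k → ℝ) (w : X → ℝ) (τ ε B cA r : ℝ) (σ : Alg3State X k)
    (x : X) : (alg3Step g w τ ε B cA r σ x).U =
      if (∃ j : ℕ, Act (newL g w τ ε σ.L x) σ.U ((1 - ε) ^ j * B) ∧
          (1 - ε) * τ / r ≤ g ((alg3Step g w τ ε B cA r σ x).sol j)) then
        sInf {u : ℝ | ∃ j : ℕ, u = (1 - ε) ^ j * B ∧
          Act (newL g w τ ε σ.L x) σ.U ((1 - ε) ^ j * B) ∧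
          (1 - ε) * τ / r ≤ g ((alg3Step g w τ ε B cA r σ x).sol j)}
      else σ.U := rfl

theorem finite_guess {ε B L : ℝ} (hε0 : 0 < ε) (hε1 : ε < 1) (hL : 0 < L) :
    {j : ℕ | L ≤ (1 - ε) ^ j * B}.Finite := by
  have h : Filter.Tendsto (fun j : ℕ => (1 - ε) ^ j * B) Filter.atTop (nhds (0 * B)) :=
    (tendsto_pow_atTop_nhds_zero_of_lt_one (by linarith) (by linarith)).mul_const B
  rw [zero_mul] at h
  have h2 := h.eventually (gt_mem_nhds hL)
  rw [Filter.eventually_atTop] at h2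
  obtain ⟨N, hN⟩ := h2
  refine (Set.finite_lt_nat N).subset ?_
  intro j hj
  by_contra hc
  exact absurd (hN j (not_lt.1 hc)) (not_lt.2 hj)

/-- Invariant for the lower bound. -/
def InvL [NeZero k] (g : KSet X k → ℝ) (w : X → ℝ) (τ ε : ℝ) (done : List X) :
    Option ℝ → Prop
  | none => ∀ x ∈ done, gmax g x ≤ 0
  | some L => 0 < L ∧ ∀ x ∈ done, gmax g x * L ≤ ε * τ * w x

theorem newL_spec [NeZero k] {g : KSet X k → ℝ} {w : X → ℝ} (hw : ∀ x, 0 < w x) {τ ε : ℝ}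
    (hτ : 0 < τ) (hε : 0 < ε) {done : List X} {L : Option ℝ} (h : InvL g w τ ε done L) (x : X) :
    InvL g w τ ε (done ++ [x]) (newL g w τ ε L x) ∧
    (newL g w τ ε L x = none → L = none) ∧
    (L ≠ none → ∀ l, (∀ L' ∈ L, L' ≤ l) → ∀ L' ∈ newL g w τ ε L x, L' ≤ l) := by
  have hετ : 0 < ε * τ := mul_pos hε hτ
  have hwx := hw x
  cases L with
  | none =>
    simp only [newL]
    split_ifs with h1
    · have hg : 0 < gmax g x := by
        by_contra hc
        exact absurd h1 (not_lt.2 (div_nonpos_of_nonpos_of_nonneg (not_lt.1 hc) hwx.le))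
      refine ⟨⟨by positivity, ?_⟩, by simp, by simp⟩
      intro y hy
      rcases List.mem_append.1 hy with hy | hy
      · have := h y hy
        have h0 : 0 < ε * τ * w x / gmax g x := by positivity
        have := hw y
        exact (mul_nonpos_of_nonpos_of_nonneg (h y hy) h0.le).trans (by positivity)
      · rw [List.mem_singleton] at hy; subst hy
        apply le_of_eq; field_simp
    · refine ⟨?_, by simp, by simp⟩
      intro y hy
      rcases List.mem_append.1 hy with hy | hy
      · exact h y hy
      · rw [List.mem_singleton] at hy; subst hy
        by_contra hc
        exact h1 (div_pos (not_le.1 hc) hwx)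
  | some L =>
    obtain ⟨hL, hd⟩ := h
    simp only [newL]
    split_ifs with h1
    · have hg : 0 < gmax g x := by
        have h0 : 0 < gmax g x / w x := (div_pos hετ hL).trans h1
        by_contra hc
        exact absurd h0 (not_lt.2 (div_nonpos_of_nonpos_of_nonneg (not_lt.1 hc) hwx.le))
      have hlt : ε * τ * w x / gmax g x ≤ L := by
        rw [div_lt_div_iff₀ hL hwx] at h1
        rw [div_le_iff₀ hg]; linarith
      have h0 : 0 < ε * τ * w x / gmax g x := by positivity
      refine ⟨⟨h0, ?_⟩, by simp, ?_⟩
      · intro y hy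
        rcases List.mem_append.1 hy with hy | hy
        · by_cases hgy : 0 ≤ gmax g y
          · exact (mul_le_mul_of_nonneg_left hlt hgy).trans (hd y hy)
          · have := hw y
            exact (mul_nonpos_of_nonpos_of_nonneg (not_le.1 hgy).le h0.le).trans (by positivity)
        · rw [List.mem_singleton] at hy; subst hy
          apply le_of_eq; field_simp
      · intro _ l hl L' hL'
        simp only [Option.mem_def, Option.some.injEq] at hL'
        have := hl L rfl
        linarith
    · refine ⟨⟨hL, ?_⟩, by simp, fun _ l hl => hl⟩
      intro y hy
      rcases List.mem_append.1 hy with hy | hy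
      · exact hd y hy
      · rw [List.mem_singleton] at hy; subst hy
        rw [not_lt, div_le_div_iff₀ hwx hL] at h1
        exact h1

/-- Full invariant of Algorithm 3. -/
structure Inv3 [NeZero k] (g : KSet X k → ℝ) (w : X → ℝ) (τ ε B cA r : ℝ) (v : KSet X k)
    (js : ℕ) (done : List X) (σ : Alg3State X k) : Prop where
  hL : InvL g w τ ε done σ.L
  hbot : σ.L = none → ∀ j, σ.sol j = KSet.bot X k
  hU : σ.U = B ∨ ∃ j : ℕ, σ.U = (1 - ε) ^ j * B ∧ (∀ L ∈ σ.L, L ≤ (1 - ε) ^ j * B) ∧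
    (1 - ε) * τ / r ≤ g (σ.sol j)
  hwt : ∀ j : ℕ, wtot w (σ.sol j) ≤ cA * ((1 - ε) ^ j * B)
  hnone : ∀ j, ∀ x, x ∉ done → σ.sol j x = none
  hstar : (1 - ε) ^ js * B ≤ σ.U →
    InvStar g w ((1 - ε) * τ / r) r (ε * τ / ((1 - ε) ^ js * B)) v done (σ.sol js)
  hlow : done ≠ [] → (∀ L ∈ σ.L, L ≤ (1 - ε) ^ js * B) →
    (1 - ε) * τ / r ≤ g (σ.sol js) → σ.U ≤ (1 - ε) ^ js * B

theorem inv3_step [NeZero k] {g : KSet X k → ℝ} (hsub : KSubmodular g)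
    (hnorm : g (KSet.bot X k) = 0) {w : X → ℝ} (hw : ∀ x, 0 < w x)
    {τ ε B cA r : ℝ} (hτ : 0 < τ) (hε0 : 0 < ε) (hε1 : ε < 1) (hB : 0 < B)
    (hr : 1 ≤ r) (hcA : ε * cA = 1 + (1 - ε) / r) (hcA1 : 1 ≤ cA) (hex : Exch g r)
    {v : KSet X k} {js : ℕ} (hjs : wtot w v ≤ (1 - ε) ^ js * B)
    {done : List X} {σ : Alg3State X k} (h : Inv3 g w τ ε B cA r v js done σ)
    {x : X} (hx : x ∉ done) :
    Inv3 g w τ ε B cA r v js (done ++ [x]) (alg3Step g w τ ε B cA r σ x) := by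
  have hlam : ∀ j : ℕ, 0 < (1 - ε) ^ j * B := fun j => mul_pos (pow_pos (by linarith) j) hB
  have hετ : 0 < ε * τ := mul_pos hε0 hτ
  have hθ : ∀ j : ℕ, 0 < ε * τ / ((1 - ε) ^ j * B) := fun j => div_pos hετ (hlam j)
  have hT0 : 0 < (1 - ε) * τ / r := div_pos (mul_pos (by linarith) hτ) (by linarith)
  have hTτ : (1 - ε) * τ / r ≤ τ := by
    rw [div_le_iff₀ (by linarith)]; nlinarith
  obtain ⟨nL, nN, nM⟩ := newL_spec hw hτ hε0 h.hL x
  -- with no lower bound, everything is empty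
  have nbot : newL g w τ ε σ.L x = none →
      ∀ j, (alg3Step g w τ ε B cA r σ x).sol j = KSet.bot X k := by
    intro hn j
    have h1 := h.hbot (nN hn) j
    rw [step_sol]
    split_ifs with ha
    · have hg : gmax g x ≤ 0 := by
        rw [hn] at nL; exact nL x (by simp)
      have hsx : σ.sol j x = none := h.hnone j x hx
      rcases alg1Step_cases g w hw τ (ε * τ / ((1 - ε) ^ j * B)) (cA * ((1 - ε) ^ j * B))
        (σ.sol j) x with ⟨_, c1, _⟩ | ⟨i, c1, c2, c3, c4⟩ | ⟨c1, _⟩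
      · linarith
      · have := marg_le_gmax hsub hnorm hsx i
        have := mul_pos (hθ j) (hw x)
        linarith
      · rw [c1, h1]
    · exact h1
  -- attained infimum
  have hattain : (∃ j : ℕ, Act (newL g w τ ε σ.L x) σ.U ((1 - ε) ^ j * B) ∧
          (1 - ε) * τ / r ≤ g ((alg3Step g w τ ε B cA r σ x).sol j)) →
      ∃ j : ℕ, (alg3Step g w τ ε B cA r σ x).U = (1 - ε) ^ j * B ∧
        Act (newL g w τ ε σ.L x) σ.U ((1 - ε) ^ j * B) ∧
        (1 - ε) * τ / r ≤ g ((alg3Step g w τ ε B cA r σ x).sol j) ∧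
        ∀ j' : ℕ, Act (newL g w τ ε σ.L x) σ.U ((1 - ε) ^ j' * B) →
          (1 - ε) * τ / r ≤ g ((alg3Step g w τ ε B cA r σ x).sol j') →
          (1 - ε) ^ j * B ≤ (1 - ε) ^ j' * B := by
    intro hE
    rw [step_U, if_pos hE]
    set S : Set ℝ := {u : ℝ | ∃ j : ℕ, u = (1 - ε) ^ j * B ∧
          Act (newL g w τ ε σ.L x) σ.U ((1 - ε) ^ j * B) ∧
          (1 - ε) * τ / r ≤ g ((alg3Step g w τ ε B cA r σ x).sol j)} with hS
    have hne : S.Nonempty := by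
      obtain ⟨j, hj⟩ := hE; exact ⟨_, j, rfl, hj⟩
    have hfin : S.Finite := by
      cases hN : newL g w τ ε σ.L x with
      | none =>
        exfalso
        obtain ⟨j, hj, hj2⟩ := hE
        rw [nbot hN j, hnorm] at hj2
        linarith
      | some L =>
        rw [hN] at nL
        refine ((finite_guess (B := B) hε0 hε1 nL.1).image (fun j => (1 - ε) ^ j * B)).subset ?_
        rintro u ⟨j, rfl, ha, _⟩
        exact ⟨j, ha.1 L (by rw [hN]; rfl), rfl⟩
    obtain ⟨j, hj1, hj2, hj3⟩ := hne.csInf_mem hfin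
    refine ⟨j, hj1, hj2, hj3, ?_⟩
    intro j' h1 h2
    rw [← hj1]
    exact csInf_le hfin.bddBelow ⟨j', rfl, h1, h2⟩
  have hUle : (alg3Step g w τ ε B cA r σ x).U ≤ σ.U := by
    by_cases hE : ∃ j : ℕ, Act (newL g w τ ε σ.L x) σ.U ((1 - ε) ^ j * B) ∧
          (1 - ε) * τ / r ≤ g ((alg3Step g w τ ε B cA r σ x).sol j)
    · obtain ⟨j, h1, h2, _⟩ := hattain hE
      rw [h1]; exact h2.2
    · rw [step_U, if_neg hE]
  refine ⟨nL, nbot, ?_, ?_, ?_, ?_, ?_⟩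
  · by_cases hE : ∃ j : ℕ, Act (newL g w τ ε σ.L x) σ.U ((1 - ε) ^ j * B) ∧
          (1 - ε) * τ / r ≤ g ((alg3Step g w τ ε B cA r σ x).sol j)
    · obtain ⟨j, h1, h2, h3, _⟩ := hattain hE
      exact Or.inr ⟨j, h1, h2.1, h3⟩
    · left
      have hUe : (alg3Step g w τ ε B cA r σ x).U = σ.U := by rw [step_U, if_neg hE]
      rw [hUe]
      rcases h.hU with h1 | ⟨j, h1, h2, h3⟩
      · exact h1
      · exfalso
        apply hE
        have hLn : σ.L ≠ none := by
          intro hn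
          rw [h.hbot hn j, hnorm] at h3
          linarith
        have ha : Act (newL g w τ ε σ.L x) σ.U ((1 - ε) ^ j * B) :=
          ⟨nM hLn _ h2, h1.ge⟩
        refine ⟨j, ha, ?_⟩
        rw [step_sol, if_pos ha]
        exact alg1Step_thr g w hw (hθ j).le hTτ h3
  · intro j
    rw [step_sol]
    split_ifs
    · exact alg1Step_wt g w hw (h.hnone j x hx) (h.hwt j)
    · exact h.hwt j
  · intro j y hy
    simp only [List.mem_append, List.mem_singleton, not_or] at hy
    rw [step_sol]
    split_ifs
    · exact alg1Step_none g w hw hy.2 (h.hnone j y hy.1)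
    · exact h.hnone j y hy.1
  · intro hle
    have hs := h.hstar (hle.trans hUle)
    have hsx : σ.sol js x = none := h.hnone js x hx
    rw [step_sol]
    split_ifs with ha
    · refine invStar_step hsub hnorm hw (hθ js).le hTτ hex ?_ ?_ hsx hs
      · have := mul_le_mul_of_nonneg_right hcA1 (hlam js).le
        linarith
      · have hne := (hlam js).ne'
        calc ε * τ / ((1 - ε) ^ js * B) * (cA * ((1 - ε) ^ js * B))
            = τ * (ε * cA) * (((1 - ε) ^ js * B) / ((1 - ε) ^ js * B)) := by ring
          _ = τ + (1 - ε) * τ / r := by rw [div_self hne, hcA]; ring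
    · apply invStar_skip hs
      intro i _
      have hna : ¬ (∀ L' ∈ newL g w τ ε σ.L x, L' ≤ (1 - ε) ^ js * B) := fun h1 =>
        ha ⟨h1, hle.trans hUle⟩
      push Not at hna
      obtain ⟨L, hL1, hL2⟩ := hna
      rw [Option.mem_def] at hL1
      rw [hL1] at nL
      have h1 := nL.2 x (by simp)
      refine (marg_le_gmax hsub hnorm hsx i).trans ?_
      rw [div_mul_eq_mul_div, le_div_iff₀ (hlam js)]
      by_cases hg : 0 ≤ gmax g x
      · exact (mul_le_mul_of_nonneg_left hL2.le hg).trans h1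
      · have := mul_pos hετ (hw x)
        have := mul_nonpos_of_nonpos_of_nonneg (not_le.1 hg).le (hlam js).le
        linarith
  · intro _ hact hT
    by_cases hc : (1 - ε) ^ js * B ≤ σ.U
    · obtain ⟨j, h1, _, _, h4⟩ := hattain ⟨js, ⟨hact, hc⟩, hT⟩
      rw [h1]; exact h4 js ⟨hact, hc⟩ hT
    · exact hUle.trans (not_le.1 hc).le

theorem inv3_fold [NeZero k] {g : KSet X k → ℝ} (hsub : KSubmodular g)
    (hnorm : g (KSet.bot X k) = 0) {w : X → ℝ} (hw : ∀ x, 0 < w x)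
    {τ ε B cA r : ℝ} (hτ : 0 < τ) (hε0 : 0 < ε) (hε1 : ε < 1) (hB : 0 < B)
    (hr : 1 ≤ r) (hcA : ε * cA = 1 + (1 - ε) / r) (hcA1 : 1 ≤ cA) (hex : Exch g r)
    {v : KSet X k} {js : ℕ} (hjs : wtot w v ≤ (1 - ε) ^ js * B) (l : List X) :
    ∀ (done : List X) (σ : Alg3State X k), Inv3 g w τ ε B cA r v js done σ →
      (done ++ l).Nodup →
      Inv3 g w τ ε B cA r v js (done ++ l) (l.foldl (alg3Step g w τ ε B cA r) σ) := by
  induction l with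
  | nil => intro done σ h _; simpa using h
  | cons x l ih =>
    intro done σ h hnd
    have hx : x ∉ done := by
      intro hx
      rw [List.nodup_append] at hnd
      exact hnd.2.2 x hx x (by simp) rfl
    have e : done ++ x :: l = (done ++ [x]) ++ l := by simp
    rw [e] at hnd ⊢
    rw [List.foldl_cons]
    exact ih _ _ (inv3_step hsub hnorm hw hτ hε0 hε1 hB hr hcA hcA1 hex hjs h hx) hnd

theorem alg3_main [NeZero k] {g : KSet X k → ℝ} (hsub : KSubmodular g)
    (hnorm : g (KSet.bot X k) = 0) {w : X → ℝ} (hw : ∀ x, 0 < w x)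
    {τ ε B cA r : ℝ} (hτ : 0 < τ) (hε0 : 0 < ε) (hε1 : ε < 1)
    (hr : 1 ≤ r) (hcA : ε * cA = 1 + (1 - ε) / r) (hcA1 : 1 ≤ cA) (hex : Exch g r)
    {v : KSet X k} (hgv : τ ≤ g v) (hB : wtot w v ≤ B)
    (order : List X) (hnodup : order.Nodup) (hfull : ∀ x : X, x ∈ order) :
    (∃ x : KSet X k, IsAlg3Output g w τ ε B cA r order x) ∧
      ∀ x : KSet X k, IsAlg3Output g w τ ε B cA r order x →
        wtot w x ≤ cA / (1 - ε) * wtot w v ∧ (1 - ε) * τ / r ≤ g x := by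
  obtain ⟨x0, hx0⟩ : ∃ x, v x ≠ none := by
    by_contra hc
    push Not at hc
    have : v = KSet.bot X k := funext hc
    rw [this, hnorm] at hgv; linarith
  have hwv : 0 < wtot w v := (hw x0).trans_le (w_le_wtot hw hx0)
  have hB0 : 0 < B := hwv.trans_le hB
  have h1ε : 0 < 1 - ε := by linarith
  obtain ⟨js, hj1, hj2⟩ := exists_nat_pow_near_of_lt_one (x := wtot w v / B) (y := 1 - ε)
    (div_pos hwv hB0) ((div_le_one hB0).2 hB) h1ε (by linarith)
  rw [lt_div_iff₀ hB0] at hj1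
  rw [div_le_iff₀ hB0] at hj2
  have hlam : ∀ j : ℕ, 0 < (1 - ε) ^ j * B := fun j => mul_pos (pow_pos h1ε j) hB0
  have hετ : 0 < ε * τ := mul_pos hε0 hτ
  have hcA0 : 0 < cA := by linarith
  have hinit : Inv3 g w τ ε B cA r v js [] ⟨none, B, fun _ => KSet.bot X k⟩ := by
    refine ⟨by intro x hx; simp at hx, fun _ _ => rfl, Or.inl rfl, ?_, fun _ _ _ => rfl, ?_,
      fun h => absurd rfl h⟩
    · intro j
      simp only [wtot_bot]
      exact (mul_pos hcA0 (hlam j)).le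
    · intro _
      right
      have : ovr (KSet.bot X k) v = v := by funext y; simp [ovr, KSet.bot]
      simp [this, hnorm, wtot_bot]
  have hI := inv3_fold hsub hnorm hw hτ hε0 hε1 hB0 hr hcA hcA1 hex hj2 order [] _ hinit
    (by simpa using hnodup)
  rw [List.nil_append] at hI
  change Inv3 g w τ ε B cA r v js order (alg3Run g w τ ε B cA r order) at hI
  unfold IsAlg3Output
  generalize alg3Run g w τ ε B cA r order = σ at hI ⊢
  have hsubadd : ∀ c : X → ℝ, (∀ x, 0 ≤ c x) → (∀ x, gmax g x ≤ c x) → g v ≤ wtot c v := by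
    intro c hc0 hc
    have := g_le_sum hsub (bot_le' v) c hc0 (fun x hx i _ =>
      (marg_le_gmax hsub hnorm hx i).trans (hc x))
    rw [hnorm, zero_add] at this
    simpa [wtot, KSet.bot] using this
  -- the lower bound
  obtain ⟨L, hLe, hL0, hLs⟩ : ∃ L, σ.L = some L ∧ 0 < L ∧ L ≤ (1 - ε) ^ js * B := by
    have hL := hI.hL
    cases hc : σ.L with
    | none =>
      exfalso
      rw [hc] at hL
      have := hsubadd (fun _ => 0) (fun _ => le_rfl) (fun x => hL x (hfull x))
      simp [wtot] at this
      linarith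
    | some L =>
      rw [hc] at hL
      refine ⟨L, rfl, hL.1, ?_⟩
      have h0 := hL.1
      have := hsubadd (fun x => ε * τ / L * w x) (fun x => by have := hw x; positivity)
        (fun x => by
          rw [div_mul_eq_mul_div, le_div_iff₀ h0]; exact hL.2 x (hfull x))
      have e : wtot (fun x => ε * τ / L * w x) v = ε * τ / L * wtot w v := by
        unfold wtot; rw [Finset.mul_sum]
      rw [e, div_mul_eq_mul_div, le_div_iff₀ h0] at this
      have h2 : τ * L ≤ τ * (ε * wtot w v) := by
        have := mul_le_mul_of_nonneg_right hgv h0.le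
        linarith
      have h3 := le_of_mul_le_mul_left h2 hτ
      nlinarith
  have hLact : ∀ j : ℕ, (∀ L' ∈ σ.L, L' ≤ (1 - ε) ^ j * B) ↔ L ≤ (1 - ε) ^ j * B := by
    intro j; rw [hLe]; simp
  have hstarT : (1 - ε) ^ js * B ≤ σ.U → (1 - ε) * τ / r ≤ g (σ.sol js) := by
    intro hle
    refine invStar_final hsub hw (div_pos hετ (hlam js)).le (by linarith) hgv ?_ hfull
      (hI.hstar hle)
    have h1 : ε * τ / ((1 - ε) ^ js * B) * wtot w v ≤ ε * τ := by
      rw [div_mul_eq_mul_div, div_le_iff₀ (hlam js)]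
      exact mul_le_mul_of_nonneg_left hj2 hετ.le
    have h2 : r * ((1 - ε) * τ / r) = (1 - ε) * τ := by
      field_simp
    rw [h2]; linarith
  have hUs : σ.U ≤ (1 - ε) ^ js * B := by
    by_cases hc : (1 - ε) ^ js * B ≤ σ.U
    · exact hI.hlow (List.ne_nil_of_mem (hfull x0)) ((hLact js).2 hLs) (hstarT hc)
    · exact (not_le.1 hc).le
  obtain ⟨jg, hg1, hg2, hg3⟩ : ∃ j : ℕ, L ≤ (1 - ε) ^ j * B ∧ (1 - ε) ^ j * B ≤ σ.U ∧
      (1 - ε) * τ / r ≤ g (σ.sol j) := by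
    by_cases hc : (1 - ε) ^ js * B ≤ σ.U
    · exact ⟨js, hLs, hc, hstarT hc⟩
    · rcases hI.hU with h1 | ⟨j, h1, h2, h3⟩
      · exfalso
        apply hc
        rw [h1]
        have : (1 - ε) ^ js ≤ 1 := pow_le_one₀ h1ε.le (by linarith)
        nlinarith
      · exact ⟨j, (hLact j).1 h2, h1.ge, h3⟩
  constructor
  · have hfin : {j : ℕ | L ≤ (1 - ε) ^ j * B ∧ (1 - ε) ^ j * B ≤ σ.U}.Finite :=
      (finite_guess hε0 hε1 hL0).subset fun j hj => hj.1
    obtain ⟨j, hj, hmax⟩ := Set.exists_max_image _ (fun j => g (σ.sol j)) hfin ⟨jg, hg1, hg2⟩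
    exact ⟨_, j, (hLact j).2 hj.1, hj.2, rfl,
      fun j' h1 h2 => hmax j' ⟨(hLact j').1 h1, h2⟩⟩
  · rintro x ⟨j, h1, h2, rfl, h4⟩
    refine ⟨?_, hg3.trans (h4 jg ((hLact jg).2 hg1) hg2)⟩
    have h5 := hI.hwt j
    have h6 : (1 - ε) ^ js * B ≤ wtot w v / (1 - ε) := by
      rw [le_div_iff₀ h1ε]
      have : (1 - ε) ^ (js + 1) * B = (1 - ε) ^ js * B * (1 - ε) := by ring
      linarith
    have h7 := mul_le_mul_of_nonneg_left ((h2.trans hUs).trans h6) hcA0.le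
    calc _ ≤ _ := h5
      _ ≤ _ := h7
      _ = _ := by ring

end Helpers

/-- **Theorem 3, approximation guarantee.** Let `v` be a
minimum-weight `k`-set among those with `g v ≥ τ`, and let `B ≥ w(v)`.  If `g`
is monotone, any output of Algorithm 3 with inputs `(τ, B, ε)` satisfies
`w(x) ≤ ((3-ε)/(2ε(1-ε)))·w(v)` and `g x ≥ (1-ε)τ/2`; if `k ≥ 2` (for `g` not
assumed monotone), any output satisfies `w(x) ≤ ((4-ε)/(3ε(1-ε)))·w(v)` and
`g x ≥ (1-ε)τ/3`. -/
theorem theorem3_guarantee {X : Type*} [Fintype X] [DecidableEq X] {k : ℕ} [NeZero k]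
    (g : KSet X k → ℝ) (hnn : ∀ s : KSet X k, 0 ≤ g s) (hsub : KSubmodular g)
    (hnorm : g (KSet.bot X k) = 0)
    (w : X → ℝ) (hw : ∀ x, 0 < w x)
    (τ ε : ℝ) (hτ : 0 < τ) (hτle : ∃ s : KSet X k, τ ≤ g s)
    (hε0 : 0 < ε) (hε1 : ε < 1)
    (v : KSet X k) (hgv : τ ≤ g v)
    (hvmin : ∀ u : KSet X k, τ ≤ g u → wtot w v ≤ wtot w u)
    (B : ℝ) (hB : wtot w v ≤ B)
    (order : List X) (hnodup : order.Nodup) (hfull : ∀ x : X, x ∈ order) :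
    (KMonotone g →
      (∃ x : KSet X k, IsAlg3Output g w τ ε B ((3 - ε) / (2 * ε)) 2 order x) ∧
      ∀ x : KSet X k, IsAlg3Output g w τ ε B ((3 - ε) / (2 * ε)) 2 order x →
        wtot w x ≤ (3 - ε) / (2 * ε * (1 - ε)) * wtot w v ∧
        (1 - ε) * τ / 2 ≤ g x) ∧
    (2 ≤ k →
      (∃ x : KSet X k, IsAlg3Output g w τ ε B ((4 - ε) / (3 * ε)) 3 order x) ∧
      ∀ x : KSet X k, IsAlg3Output g w τ ε B ((4 - ε) / (3 * ε)) 3 order x →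
        wtot w x ≤ (4 - ε) / (3 * ε * (1 - ε)) * wtot w v ∧
        (1 - ε) * τ / 3 ≤ g x) := by
  constructor
  · intro hm
    have h := alg3_main hsub hnorm hw (cA := (3 - ε) / (2 * ε)) hτ hε0 hε1 (r := 2) (by norm_num)
      (by field_simp; ring) (by rw [le_div_iff₀ (by linarith)]; linarith)
      (exch_mono hsub hm) hgv hB order hnodup hfull
    rw [div_div] at h
    exact h
  · intro hk
    have h := alg3_main hsub hnorm hw (cA := (4 - ε) / (3 * ε)) hτ hε0 hε1 (r := 3) (by norm_num)
      (by field_simp; ring) (by rw [le_div_iff₀ (by linarith)]; linarith)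
      (exch_pair hsub hk) hgv hB order hnodup hfull
    rw [div_div] at h
    exact h
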